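/- arXiv:2601.11470 — 2 statements merged into one kernel-verified Lean document; each statement's English description precedes it below -/
import Mathlib

section
/- Let μ be a Borel probability measure on ℝ with support X, let r = (r_n)_{n≥1} be a non-increasing sequence of positive real numbers tending to zero with sup_{x∈X} μ(B(x,r_1)) < 1, and let C ⊆ X_0 be a non-empty compact set. Let ν be a Borel probability measure supported in C such that for every M > 0, lim_{k→∞} ν({x ∈ C : ∫ p_k(x,y) dν(y) ≥ M}) = 1. Then there exists a Borel set C_ν ⊆ C with ν(C_ν) = 1 such that ℙ_μ({ω : C_ν ⊆ E_r(ω)}) = 1. -/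
open MeasureTheory Metric Filter Set
open scoped ENNReal Topology

noncomputable section

/-- The random covering set `E_r(ω) = limsup_n B(ω_n, r_n)`. -/
def coverSet (r : ℕ → ℝ) (ω : ℕ → ℝ) : Set ℝ :=
  ⋂ k, ⋃ n, ⋃ (_ : k ≤ n), ball (ω n) (r n)

/-- The topological support of a measure. -/
def msupport (μ : Measure ℝ) : Set ℝ :=
  {x | ∀ U : Set ℝ, IsOpen U → x ∈ U → 0 < μ U}

/-- `p_k(x,y)`. -/
def pk (μ : Measure ℝ) (r : ℕ → ℝ) (k : ℕ) (x y : ℝ) : ℝ :=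
  ∏ n ∈ Finset.range k,
    (1 - (μ (ball x (r n))).toReal - (μ (ball y (r n))).toReal +
        (μ (ball x (r n) ∩ ball y (r n))).toReal) /
      ((1 - (μ (ball x (r n))).toReal) * (1 - (μ (ball y (r n))).toReal))

/-- `X₀`, the points of the support all of whose ball boundaries are `μ`-null. -/
def X₀ (μ : Measure ℝ) (r : ℕ → ℝ) : Set ℝ :=
  {x ∈ msupport μ | ∀ k : ℕ, μ (frontier (ball x (r k))) = 0}

/-- A one-coordinate Chebyshev association inequality: if `h` takes its minimal value on `R`, and
`g ≤ 1` equals `1` off `R`, then `g` and `h` are positively correlated. -/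
lemma lintegral_mul_lintegral_le_of_association {α : Type*} [MeasurableSpace α] (ρ : Measure α)
    (V R : Set α) (hρ : ∀ᵐ t ∂ρ, t ∈ V) {g h : α → ℝ≥0∞} (hg : Measurable g)
    (hh : Measurable h) (hg1 : ∀ t, g t ≤ 1) (hgR : ∀ t ∈ V, t ∉ R → g t = 1)
    (hhR : ∀ t ∈ V, ∀ t' ∈ V, t' ∈ R → h t' ≤ h t) :
    (∫⁻ t, g t ∂ρ) * ∫⁻ t, h t ∂ρ ≤ ρ univ * ∫⁻ t, g t * h t ∂ρ := by
  obtain ⟨a, haV, haR⟩ : ∃ a, (∀ t ∈ V, a ≤ h t) ∧ ∀ t ∈ V, t ∈ R → h t = a := by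
    by_cases hne : (V ∩ R).Nonempty
    · obtain ⟨t₀, ht₀, ht₀R⟩ := hne
      exact ⟨h t₀, fun t ht => hhR t ht t₀ ht₀ ht₀R,
        fun t ht htR => le_antisymm (hhR t₀ ht₀ t ht htR) (hhR t ht t₀ ht₀ ht₀R)⟩
    · exact ⟨0, fun _ _ => zero_le, fun t ht htR => (hne ⟨t, ht, htR⟩).elim⟩
  have hsub : Measurable fun t => h t - a := hh.sub_const a
  have h₁ : ∫⁻ t, h t ∂ρ = a * ρ univ + ∫⁻ t, (h t - a) ∂ρ := by
    rw [← lintegral_const, ← lintegral_add_left measurable_const]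
    refine lintegral_congr_ae ?_
    filter_upwards [hρ] with t ht
    exact (add_tsub_cancel_of_le (haV t ht)).symm
  have h₂ : ∫⁻ t, g t * h t ∂ρ = a * ∫⁻ t, g t ∂ρ + ∫⁻ t, (h t - a) ∂ρ := by
    rw [← lintegral_const_mul a hg, ← lintegral_add_left (hg.const_mul a)]
    refine lintegral_congr_ae ?_
    filter_upwards [hρ] with t ht
    by_cases htR : t ∈ R
    · simp [haR t ht htR, mul_comm]
    · simp [hgR t ht htR, add_tsub_cancel_of_le (haV t ht)]
  have h₃ : ∫⁻ t, g t ∂ρ ≤ ρ univ := by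
    simpa using lintegral_mono (μ := ρ) hg1
  rw [h₁, h₂, mul_add, mul_add]
  refine add_le_add (le_of_eq (by ring)) (by gcongr)

/-- Association inequality for finite product measures. -/
lemma prod_lintegral_mul_lmarginal_le {ι α : Type*} [DecidableEq ι] [MeasurableSpace α]
    (ρ : ι → Measure α) [∀ i, IsFiniteMeasure (ρ i)] (V R : ι → Set α)
    (hρ : ∀ i, ∀ᵐ t ∂ρ i, t ∈ V i) {g : ι → α → ℝ≥0∞} (hg : ∀ i, Measurable (g i))
    (hg1 : ∀ i t, g i t ≤ 1) (hgR : ∀ i, ∀ t ∈ V i, t ∉ R i → g i t = 1)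
    {f : (ι → α) → ℝ≥0∞} (hf : Measurable f) (s : Finset ι)
    (hfR : ∀ i ∈ s, ∀ ω, ∀ t ∈ V i, ∀ t' ∈ V i, t' ∈ R i →
      f (Function.update ω i t') ≤ f (Function.update ω i t)) (x : ι → α) :
    (∏ i ∈ s, ∫⁻ t, g i t ∂ρ i) * (lmarginal (fun i => ρ i) s f) x ≤
      (∏ i ∈ s, ρ i univ) * (lmarginal (fun i => ρ i) s fun ω => (∏ i ∈ s, g i (ω i)) * f ω) x := by
  induction s using Finset.induction generalizing x with
  | empty => simp
  | insert j s hj ih =>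
    have hmeas : ∀ s : Finset ι, Measurable fun ω : ι → α => (∏ i ∈ s, g i (ω i)) * f ω :=
      fun s => (Finset.measurable_prod _ fun i _ => (hg i).comp (measurable_pi_apply i)).mul hf
    have ih' := ih fun i hi => hfR i (Finset.mem_insert_of_mem hi)
    have hupd : ∀ t, (lmarginal (fun i => ρ i) s fun ω => (∏ i ∈ insert j s, g i (ω i)) * f ω)
        (Function.update x j t) =
        g j t * (lmarginal (fun i => ρ i) s fun ω => (∏ i ∈ s, g i (ω i)) * f ω)
          (Function.update x j t) := by
      intro t
      rw [lmarginal_update_of_notMem (hmeas _) hj, lmarginal_update_of_notMem (hmeas _) hj]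
      simp only [lmarginal, Function.comp_apply]
      rw [← lintegral_const_mul]
      · refine lintegral_congr fun y => ?_
        rw [Finset.prod_insert hj, Function.update_self, mul_assoc]
      · exact (hmeas s).comp (measurable_update_left.comp measurable_updateFinset)
    rw [lmarginal_insert _ hf hj, lmarginal_insert _ (hmeas _) hj, Finset.prod_insert hj,
      Finset.prod_insert hj]
    simp_rw [hupd]
    have hF : Measurable fun t => (lmarginal (fun i => ρ i) s f) (Function.update x j t) :=
      (hf.lmarginal _).comp (measurable_update x)
    have hone := lintegral_mul_lintegral_le_of_association (ρ j) (V j) (R j) (hρ j) (hg j) hF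
      (hg1 j) (hgR j) (by
        intro t ht t' ht' htR'
        rw [lmarginal_update_of_notMem hf hj, lmarginal_update_of_notMem hf hj]
        exact lmarginal_mono (fun ω => hfR j (Finset.mem_insert_self j s) ω t ht t' ht' htR') x)
    calc (∫⁻ t, g j t ∂ρ j) * (∏ i ∈ s, ∫⁻ t, g i t ∂ρ i) *
          ∫⁻ t, (lmarginal (fun i => ρ i) s f) (Function.update x j t) ∂ρ j
        = (∏ i ∈ s, ∫⁻ t, g i t ∂ρ i) * ((∫⁻ t, g j t ∂ρ j) *
          ∫⁻ t, (lmarginal (fun i => ρ i) s f) (Function.update x j t) ∂ρ j) := by ring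
      _ ≤ (∏ i ∈ s, ∫⁻ t, g i t ∂ρ i) * (ρ j univ *
          ∫⁻ t, g j t * (lmarginal (fun i => ρ i) s f) (Function.update x j t) ∂ρ j) := by
        gcongr
      _ = ρ j univ * ∫⁻ t, g j t * ((∏ i ∈ s, ∫⁻ t, g i t ∂ρ i) *
          (lmarginal (fun i => ρ i) s f) (Function.update x j t)) ∂ρ j := by
        rw [mul_left_comm, ← lintegral_const_mul _ (f := fun t => g j t * _) ((hg j).mul hF)]
        simp_rw [mul_left_comm]
      _ ≤ ρ j univ * ∫⁻ t, g j t * ((∏ i ∈ s, ρ i univ) *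
          (lmarginal (fun i => ρ i) s fun ω => (∏ i ∈ s, g i (ω i)) * f ω)
            (Function.update x j t)) ∂ρ j := by
        refine mul_le_mul_right (lintegral_mono fun t => mul_le_mul_right (ih' _) _) _
      _ = _ := by
        simp_rw [mul_left_comm (g j _)]
        rw [mul_assoc, lintegral_const_mul]
        exact (hg j).mul (((hmeas s).lmarginal _).comp (measurable_update x))

/-- Restricting each factor of a finite product amounts to intersecting with a box. -/
lemma lmarginal_restrict_indicator {ι α : Type*} [DecidableEq ι] [MeasurableSpace α]
    (μ : Measure α) [IsProbabilityMeasure μ] (N : Finset ι) {V : ι → Set α}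
    (hV : ∀ i, MeasurableSet (V i)) {E : Set (ι → α)} (hE : MeasurableSet E)
    (hdep : ∀ ω ω' : ι → α, (∀ i ∈ N, ω i = ω' i) → ω ∈ E → ω' ∈ E) (x : ι → α) :
    (lmarginal (fun i => μ.restrict (V i)) N (E.indicator 1)) x =
      Measure.infinitePi (fun _ : ι => μ) (E ∩ {ω | ∀ i ∈ N, ω i ∈ V i}) := by
  have hpre : MeasurableSet ((Function.updateFinset x N) ⁻¹' E) := measurable_updateFinset hE
  have hbox : MeasurableSet (univ.pi fun i : N => V i) := .univ_pi fun i => hV i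
  calc (lmarginal (fun i => μ.restrict (V i)) N (E.indicator 1)) x
      = ∫⁻ y, ((Function.updateFinset x N) ⁻¹' E).indicator 1 y
          ∂Measure.pi fun i : N => μ.restrict (V i) := rfl
    _ = Measure.pi (fun _ : N => μ) ((Function.updateFinset x N) ⁻¹' E ∩
          univ.pi fun i : N => V i) := by
        rw [lintegral_indicator_one hpre,
          ← Measure.restrict_pi_pi (fun _ : N => μ) (fun i : N => V i), Measure.restrict_apply hpre]
    _ = _ := by
        rw [← Measure.infinitePi_map_restrict (μ := fun _ : ι => μ),
          Measure.map_apply (by fun_prop) (hpre.inter hbox)]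
        congr 1
        ext ω
        simp only [mem_preimage, mem_inter_iff, Set.mem_pi, mem_univ, forall_const, Subtype.forall,
          Finset.restrict, mem_ofPred_eq]
        refine and_congr_left fun _ => ⟨hdep _ _ ?_, hdep _ _ ?_⟩ <;>
          intro i hi <;> simp [Function.updateFinset, hi]

/-- The event that `x` lies in none of the balls `B(ω_n, r_n)` with `n ∈ N`. -/
def uncovered (r : ℕ → ℝ) (N : Finset ℕ) (x : ℝ) : Set (ℕ → ℝ) :=
  {ω | ∀ n ∈ N, ω n ∈ (ball x (r n))ᶜ}

/-- The event that `x` is uncovered, while every earlier point of `F` is covered. Earlier refers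
to the usual order if `σ = 1` and to the reversed order if `σ = -1`. -/
def firstUncovered (r : ℕ → ℝ) (N : Finset ℕ) (σ : ℝ) (F : Finset ℝ) (x : ℝ) : Set (ℕ → ℝ) :=
  {ω | ∀ z ∈ F, σ * z < σ * x → ∃ n ∈ N, ω n ∈ ball z (r n)} ∩ uncovered r N x

/-- The factors of `p_k(x,y)` with index in `N`, as an extended non-negative number. -/
def overlap (μ : Measure ℝ) (r : ℕ → ℝ) (N : Finset ℕ) (x y : ℝ) : ℝ≥0∞ :=
  ∏ n ∈ N, μ ((ball x (r n))ᶜ ∩ (ball y (r n))ᶜ) / (μ (ball x (r n))ᶜ * μ (ball y (r n))ᶜ)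

lemma measurableSet_uncovered (r : ℕ → ℝ) (N : Finset ℕ) (x : ℝ) :
    MeasurableSet (uncovered r N x) := by
  have : uncovered r N x = ⋂ n ∈ N, (fun ω : ℕ → ℝ => ω n) ⁻¹' (ball x (r n))ᶜ := by
    ext ω; simp [uncovered]
  rw [this]
  exact .biInter N.countable_toSet fun n _ => measurable_pi_apply n measurableSet_ball.compl

lemma measurableSet_earlierCovered (r : ℕ → ℝ) (N : Finset ℕ) (σ : ℝ) (F : Finset ℝ) (x : ℝ) :
    MeasurableSet {ω : ℕ → ℝ | ∀ z ∈ F, σ * z < σ * x → ∃ n ∈ N, ω n ∈ ball z (r n)} := by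
  have : {ω : ℕ → ℝ | ∀ z ∈ F, σ * z < σ * x → ∃ n ∈ N, ω n ∈ ball z (r n)} =
      ⋂ z ∈ F, ⋂ (_ : σ * z < σ * x), ⋃ n ∈ N, (fun ω : ℕ → ℝ => ω n) ⁻¹' ball z (r n) := by
    ext ω; simp
  rw [this]
  exact .biInter F.countable_toSet fun z _ => .iInter fun _ =>
    .biUnion N.countable_toSet fun n _ => measurable_pi_apply n measurableSet_ball

lemma measurableSet_firstUncovered (r : ℕ → ℝ) (N : Finset ℕ) (σ : ℝ) (F : Finset ℝ) (x : ℝ) :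
    MeasurableSet (firstUncovered r N σ F x) :=
  (measurableSet_earlierCovered r N σ F x).inter (measurableSet_uncovered r N x)

lemma measure_uncovered (μ : Measure ℝ) [IsProbabilityMeasure μ] (r : ℕ → ℝ) (N : Finset ℕ)
    (x : ℝ) : Measure.infinitePi (fun _ : ℕ => μ) (uncovered r N x) =
      ∏ n ∈ N, μ (ball x (r n))ᶜ := by
  rw [← Measure.infinitePi_pi (fun _ : ℕ => μ) (fun n _ => measurableSet_ball.compl)]
  rfl

/-- Positive correlation of the events that `x` is the first uncovered point of `F` and that a
later point `y` is uncovered, conditionally on `x` being uncovered. -/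
lemma prod_mul_measure_firstUncovered_le (μ : Measure ℝ) [IsProbabilityMeasure μ] (r : ℕ → ℝ)
    (N : Finset ℕ) {σ : ℝ} (hσ : σ = 1 ∨ σ = -1) (F : Finset ℝ) {x y : ℝ} (hxy : σ * x ≤ σ * y) :
    (∏ n ∈ N, μ ((ball x (r n))ᶜ ∩ (ball y (r n))ᶜ)) *
        Measure.infinitePi (fun _ : ℕ => μ) (firstUncovered r N σ F x) ≤
      (∏ n ∈ N, μ (ball x (r n))ᶜ) *
        Measure.infinitePi (fun _ : ℕ => μ) (firstUncovered r N σ F x ∩ uncovered r N y) := by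
  set V : ℕ → Set ℝ := fun n => (ball x (r n))ᶜ with hV
  have hVm : ∀ n, MeasurableSet (V n) := fun n => measurableSet_ball.compl
  set G := {ω : ℕ → ℝ | ∀ z ∈ F, σ * z < σ * x → ∃ n ∈ N, ω n ∈ ball z (r n)} with hG
  have hGm : MeasurableSet G := measurableSet_earlierCovered r N σ F x
  have hGdep : ∀ ω ω' : ℕ → ℝ, (∀ i ∈ N, ω i = ω' i) → ω ∈ G → ω' ∈ G := by
    intro ω ω' h hω z hz hzx
    obtain ⟨n, hn, hb⟩ := hω z hz hzx
    exact ⟨n, hn, h n hn ▸ hb⟩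
  have hUdep : ∀ ω ω' : ℕ → ℝ, (∀ i ∈ N, ω i = ω' i) → ω ∈ uncovered r N y →
      ω' ∈ uncovered r N y := fun ω ω' h hω n hn => h n hn ▸ hω n hn
  have key := prod_lintegral_mul_lmarginal_le (fun n => μ.restrict (V n)) V
    (fun _ => {t | σ * x < σ * t}) (fun n => ae_restrict_mem (hVm n))
    (g := fun n => (ball y (r n))ᶜ.indicator 1)
    (fun n => measurable_one.indicator measurableSet_ball.compl)
    (fun n t => indicator_le (fun _ _ => le_rfl) t) (by
      intro n t ht hxt
      refine indicator_of_mem ?_ _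
      simp only [hV, mem_compl_iff, mem_ball, Real.dist_eq, not_lt, mem_ofPred_eq] at ht hxt ⊢
      rcases hσ with rfl | rfl
      · rw [abs_of_nonpos (by linarith)] at ht
        rw [abs_of_nonpos (by linarith)]
        linarith
      · rw [abs_of_nonneg (by linarith)] at ht
        rw [abs_of_nonneg (by linarith)]
        linarith)
    (f := G.indicator 1) (measurable_one.indicator hGm) N (by
      intro i hi ω t ht t' ht' hxt
      by_cases hω' : Function.update ω i t' ∈ G
      · suffices Function.update ω i t ∈ G by simp [hω', this]
        intro z hz hzx
        obtain ⟨n, hn, hb⟩ := hω' z hz hzx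
        refine ⟨n, hn, ?_⟩
        rcases eq_or_ne n i with rfl | hne
        · exfalso
          simp only [Function.update_self, hV, mem_compl_iff, mem_ball, Real.dist_eq, not_lt,
            mem_ofPred_eq] at ht' hb hxt
          rcases hσ with rfl | rfl
          · rw [abs_of_nonneg (by linarith)] at ht'
            rw [abs_of_nonneg (by linarith)] at hb
            linarith
          · rw [abs_of_nonpos (by linarith)] at ht'
            rw [abs_of_nonpos (by linarith)] at hb
            linarith
        · simpa [hne] using hb
      · rw [indicator_of_notMem hω']
        exact zero_le) 0
  have hprod : (fun ω : ℕ → ℝ => (∏ n ∈ N, (ball y (r n))ᶜ.indicator (1 : ℝ → ℝ≥0∞) (ω n)) *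
      G.indicator 1 ω) = (G ∩ uncovered r N y).indicator 1 := by
    ext ω
    by_cases hω : ω ∈ uncovered r N y
    · rw [Finset.prod_eq_one fun n hn => indicator_of_mem (hω n hn) _]
      by_cases hωG : ω ∈ G <;> simp [hω, hωG]
    · obtain ⟨n, hn, hb⟩ : ∃ n ∈ N, ω n ∉ (ball y (r n))ᶜ := by
        simpa [uncovered] using hω
      rw [Finset.prod_eq_zero hn (indicator_of_notMem hb _)]
      simp [hω]
  rw [hprod, lmarginal_restrict_indicator μ N hVm hGm hGdep,
    lmarginal_restrict_indicator μ N hVm (hGm.inter (measurableSet_uncovered r N y))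
      fun ω ω' h hω => ⟨hGdep ω ω' h hω.1, hUdep ω ω' h hω.2⟩] at key
  have hset : G ∩ uncovered r N y ∩ {ω | ∀ i ∈ N, ω i ∈ V i} =
      firstUncovered r N σ F x ∩ uncovered r N y := inter_right_comm _ _ _
  rw [hset] at key
  simp_rw [lintegral_indicator_one measurableSet_ball.compl,
    Measure.restrict_apply measurableSet_ball.compl, Measure.restrict_apply_univ,
    inter_comm (ball y _)ᶜ] at key
  exact key

/-- The pair correlation bounds the conditional probability that `x` is the first uncovered
point, given that a later point `y` is uncovered. -/
lemma measure_firstUncovered_mul_overlap_le (μ : Measure ℝ) [IsProbabilityMeasure μ] (r : ℕ → ℝ)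
    (N : Finset ℕ) {σ : ℝ} (hσ : σ = 1 ∨ σ = -1) (F : Finset ℝ) {x y : ℝ} (hxy : σ * x ≤ σ * y)
    (hx : ∀ n, μ (ball x (r n))ᶜ ≠ 0) (hy : ∀ n, μ (ball y (r n))ᶜ ≠ 0) :
    Measure.infinitePi (fun _ : ℕ => μ) (firstUncovered r N σ F x) * overlap μ r N x y ≤
      Measure.infinitePi (fun _ : ℕ => μ) (firstUncovered r N σ F x ∩ uncovered r N y) /
        Measure.infinitePi (fun _ : ℕ => μ) (uncovered r N y) := by
  have hb : ∏ n ∈ N, μ (ball x (r n))ᶜ ≠ 0 := Finset.prod_ne_zero_iff.2 fun n _ => hx n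
  have hb' : ∏ n ∈ N, μ (ball x (r n))ᶜ ≠ ∞ := ENNReal.prod_ne_top fun n _ => measure_ne_top _ _
  have h := prod_mul_measure_firstUncovered_le μ r N hσ F hxy
  have hov : overlap μ r N x y = (∏ n ∈ N, μ ((ball x (r n))ᶜ ∩ (ball y (r n))ᶜ)) /
      (∏ n ∈ N, μ (ball x (r n))ᶜ) / ∏ n ∈ N, μ (ball y (r n))ᶜ := by
    rw [overlap, ENNReal.div_eq_inv_mul, ENNReal.div_eq_inv_mul,
      ENNReal.prod_inv_distrib, ENNReal.prod_inv_distrib, ← Finset.prod_mul_distrib,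
      ← Finset.prod_mul_distrib]
    · refine Finset.prod_congr rfl fun n _ => ?_
      rw [ENNReal.div_eq_inv_mul, ENNReal.mul_inv (.inl (hx n)) (.inr (hy n)), mul_comm (_)⁻¹,
        mul_assoc]
    all_goals exact fun i _ j _ _ => .inr (by simp)
  rw [hov, measure_uncovered μ r N y, ← mul_div_assoc]
  refine ENNReal.div_le_div_right ?_ _
  rw [← mul_div_assoc, ENNReal.div_le_iff_le_mul (.inl hb) (.inl hb'), mul_comm, mul_comm _ (∏ n ∈ N, _)]
  exact h

lemma measurable_measure_compl_inter (μ : Measure ℝ) [SFinite μ] (ρ : ℝ) :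
    Measurable fun z : ℝ × ℝ => μ ((ball z.1 ρ)ᶜ ∩ (ball z.2 ρ)ᶜ) := by
  have : MeasurableSet {p : (ℝ × ℝ) × ℝ | p.2 ∈ (ball p.1.1 ρ)ᶜ ∩ (ball p.1.2 ρ)ᶜ} := by
    refine MeasurableSet.inter ?_ ?_ <;> refine MeasurableSet.compl ?_
    · exact measurableSet_lt (by fun_prop) measurable_const
    · exact measurableSet_lt (by fun_prop) measurable_const
  exact measurable_measure_prodMk_left this

lemma measurable_measure_compl_ball (μ : Measure ℝ) [SFinite μ] (ρ : ℝ) :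
    Measurable fun x : ℝ => μ (ball x ρ)ᶜ := by
  simpa only [Function.comp_def, inter_self, id] using
    (measurable_measure_compl_inter μ ρ).comp (measurable_id.prodMk measurable_id)

lemma measurable_overlap (μ : Measure ℝ) [SFinite μ] (r : ℕ → ℝ) (N : Finset ℕ) :
    Measurable fun z : ℝ × ℝ => overlap μ r N z.1 z.2 :=
  Finset.measurable_prod _ fun n _ => (measurable_measure_compl_inter μ (r n)).div
    (((measurable_measure_compl_ball μ (r n)).comp measurable_fst).mul
      ((measurable_measure_compl_ball μ (r n)).comp measurable_snd))

/-- First-passage bound: a finite set of points with large one-sided potential is likely to be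
covered. -/
lemma mul_measure_biUnion_uncovered_le_one (μ : Measure ℝ) [IsProbabilityMeasure μ] (r : ℕ → ℝ)
    (N : Finset ℕ) {σ : ℝ} (hσ : σ = 1 ∨ σ = -1) (F : Finset ℝ) (ν : Measure ℝ)
    [IsProbabilityMeasure ν] (hF : ∀ x ∈ F, ∀ n, μ (ball x (r n))ᶜ ≠ 0)
    (hν : ∀ᵐ y ∂ν, ∀ n, μ (ball y (r n))ᶜ ≠ 0) {c : ℝ≥0∞}
    (hc : ∀ x ∈ F, c ≤ ∫⁻ y in {y | σ * x ≤ σ * y}, overlap μ r N x y ∂ν) :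
    c * Measure.infinitePi (fun _ : ℕ => μ) (⋃ x ∈ F, uncovered r N x) ≤ 1 := by
  obtain ⟨P, hP⟩ : ∃ P, P = Measure.infinitePi fun _ : ℕ => μ := ⟨_, rfl⟩
  rw [← hP]
  have hσ0 : σ ≠ 0 := by rcases hσ with rfl | rfl <;> norm_num
  have hdisj : (F : Set ℝ).PairwiseDisjoint (firstUncovered r N σ F) := by
    intro x hx x' hx' hne
    refine Set.disjoint_left.2 fun ω hω hω' => ?_
    rcases lt_or_gt_of_ne (fun h => hne (mul_left_cancel₀ hσ0 h)) with h | h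
    · obtain ⟨n, hn, hb⟩ := hω'.1 x hx h
      exact hω.2 n hn hb
    · obtain ⟨n, hn, hb⟩ := hω.1 x' hx' h
      exact hω'.2 n hn hb
  have hcover : (⋃ x ∈ F, uncovered r N x) ⊆ ⋃ x ∈ F, firstUncovered r N σ F x := by
    classical
    intro ω hω
    simp only [mem_iUnion] at hω
    obtain ⟨x, hx, hxω⟩ := hω
    obtain ⟨x₀, hx₀, hmin⟩ := (F.filter fun z => ω ∈ uncovered r N z).exists_min_image
      (fun z => σ * z) ⟨x, by simp [hx, hxω]⟩
    rw [Finset.mem_filter] at hx₀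
    simp only [mem_iUnion]
    refine ⟨x₀, hx₀.1, fun z hz hzx => ?_, hx₀.2⟩
    by_contra hcon
    push Not at hcon
    exact absurd (hmin z (Finset.mem_filter.2 ⟨hz, hcon⟩)) (not_le.2 hzx)
  have hS : ∀ x : ℝ, MeasurableSet {y | σ * x ≤ σ * y} := fun x =>
    measurableSet_le measurable_const (by fun_prop)
  have hov : ∀ x, Measurable (overlap μ r N x) := fun x =>
    Measurable.of_uncurry_left (measurable_overlap μ r N)
  calc c * P (⋃ x ∈ F, uncovered r N x)
      ≤ c * ∑ x ∈ F, P (firstUncovered r N σ F x) := by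
        gcongr
        exact (measure_mono hcover).trans (measure_biUnion_finset_le _ _)
    _ = ∑ x ∈ F, P (firstUncovered r N σ F x) * c := by
        rw [mul_comm, Finset.sum_mul]
    _ ≤ ∑ x ∈ F, P (firstUncovered r N σ F x) *
          ∫⁻ y in {y | σ * x ≤ σ * y}, overlap μ r N x y ∂ν :=
        Finset.sum_le_sum fun x hx => mul_le_mul_right (hc x hx) _
    _ = ∫⁻ y, ∑ x ∈ F, {y | σ * x ≤ σ * y}.indicator
          (fun y => P (firstUncovered r N σ F x) * overlap μ r N x y) y ∂ν := by
        rw [lintegral_finsetSum _ fun x _ => ((hov x).const_mul _).indicator (hS x)]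
        refine Finset.sum_congr rfl fun x _ => ?_
        rw [lintegral_indicator (hS x), lintegral_const_mul _ (hov x)]
    _ ≤ ∫⁻ _, 1 ∂ν := by
        refine lintegral_mono_ae ?_
        filter_upwards [hν] with y hy
        calc ∑ x ∈ F, {y | σ * x ≤ σ * y}.indicator
              (fun y => P (firstUncovered r N σ F x) * overlap μ r N x y) y
            ≤ ∑ x ∈ F, P (firstUncovered r N σ F x ∩ uncovered r N y) / P (uncovered r N y) := by
              refine Finset.sum_le_sum fun x hx => ?_
              by_cases hxy : σ * x ≤ σ * y
              · rw [indicator_of_mem (show y ∈ {y | σ * x ≤ σ * y} from hxy)]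
                rw [hP]
                exact measure_firstUncovered_mul_overlap_le μ r N hσ F hxy (hF x hx) hy
              · rw [indicator_of_notMem (show y ∉ {y | σ * x ≤ σ * y} from hxy)]
                exact zero_le
          _ = P (⋃ x ∈ F, firstUncovered r N σ F x ∩ uncovered r N y) / P (uncovered r N y) := by
              rw [measure_biUnion_finset
                (fun x hx x' hx' h => (hdisj hx hx' h).mono inter_subset_left inter_subset_left)
                fun x _ => (measurableSet_firstUncovered r N σ F x).inter
                  (measurableSet_uncovered r N y)]
              simp_rw [ENNReal.div_eq_inv_mul, Finset.mul_sum]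
          _ ≤ P (uncovered r N y) / P (uncovered r N y) := by
              refine ENNReal.div_le_div_right (measure_mono ?_) _
              exact iUnion₂_subset fun _ _ => inter_subset_right
          _ ≤ 1 := ENNReal.div_self_le_one
    _ = 1 := by simp

/-- A finite set of points with large potential is likely to be covered. -/
lemma mul_measure_biUnion_uncovered_le_two (μ : Measure ℝ) [IsProbabilityMeasure μ] (r : ℕ → ℝ)
    (N : Finset ℕ) (F : Finset ℝ) (ν : Measure ℝ)
    [IsProbabilityMeasure ν] (hF : ∀ x ∈ F, ∀ n, μ (ball x (r n))ᶜ ≠ 0)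
    (hν : ∀ᵐ y ∂ν, ∀ n, μ (ball y (r n))ᶜ ≠ 0) {c : ℝ≥0∞}
    (hc : ∀ x ∈ F, 2 * c ≤ ∫⁻ y, overlap μ r N x y ∂ν) :
    c * Measure.infinitePi (fun _ : ℕ => μ) (⋃ x ∈ F, uncovered r N x) ≤ 2 := by
  classical
  obtain ⟨p, hp⟩ : ∃ p : ℝ → ℝ → Prop, p = fun σ x =>
    c ≤ ∫⁻ y in {y | σ * x ≤ σ * y}, overlap μ r N x y ∂ν := ⟨_, rfl⟩
  have hsplit : ∀ x ∈ F, p 1 x ∨ p (-1) x := by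
    intro x hx
    by_contra! hcon
    simp only [hp, not_le] at hcon
    have huniv : {y | (1 : ℝ) * x ≤ 1 * y} ∪ {y | (-1 : ℝ) * x ≤ -1 * y} = univ := by
      ext y
      simp [le_total]
    have : 2 * c < c + c := by
      calc 2 * c
          ≤ ∫⁻ y in {y | (1 : ℝ) * x ≤ 1 * y} ∪ {y | (-1 : ℝ) * x ≤ -1 * y},
              overlap μ r N x y ∂ν := by
            rw [huniv, Measure.restrict_univ]
            exact hc x hx
        _ ≤ _ := lintegral_union_le _ _ _
        _ < c + c := ENNReal.add_lt_add hcon.1 hcon.2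
    rw [two_mul] at this
    exact this.false
  have hside : ∀ σ : ℝ, σ = 1 ∨ σ = -1 → c * Measure.infinitePi (fun _ : ℕ => μ)
      (⋃ x ∈ F.filter (p σ), uncovered r N x) ≤ 1 := fun σ hσ =>
    mul_measure_biUnion_uncovered_le_one μ r N hσ (F.filter (p σ)) ν
      (fun x hx => hF x (Finset.mem_filter.1 hx).1) hν
      (fun x hx => by have := (Finset.mem_filter.1 hx).2; rwa [hp] at this)
  have hsub : (⋃ x ∈ F, uncovered r N x) ⊆ (⋃ x ∈ F.filter (p 1), uncovered r N x) ∪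
      ⋃ x ∈ F.filter (p (-1)), uncovered r N x := by
    refine iUnion₂_subset fun x hx => ?_
    rcases hsplit x hx with h | h
    · exact subset_union_of_subset_left
        (subset_biUnion_of_mem (u := uncovered r N) (Finset.mem_filter.2 ⟨hx, h⟩)) _
    · exact subset_union_of_subset_right
        (subset_biUnion_of_mem (u := uncovered r N) (Finset.mem_filter.2 ⟨hx, h⟩)) _
  calc _ ≤ c * (_ + _) := mul_le_mul_right ((measure_mono hsub).trans (measure_union_le _ _)) c
    _ ≤ 1 + 1 := by
      rw [mul_add]
      exact add_le_add (hside 1 (.inl rfl)) (hside (-1) (.inr rfl))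
    _ = 2 := one_add_one_eq_two

lemma mul_measure_biUnion_uncovered_le_two_of_countable (μ : Measure ℝ) [IsProbabilityMeasure μ]
    (r : ℕ → ℝ) (N : Finset ℕ) {D : Set ℝ} (hD : D.Countable) (ν : Measure ℝ)
    [IsProbabilityMeasure ν] (hF : ∀ x ∈ D, ∀ n, μ (ball x (r n))ᶜ ≠ 0)
    (hν : ∀ᵐ y ∂ν, ∀ n, μ (ball y (r n))ᶜ ≠ 0) {c : ℝ≥0∞}
    (hc : ∀ x ∈ D, 2 * c ≤ ∫⁻ y, overlap μ r N x y ∂ν) :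
    c * Measure.infinitePi (fun _ : ℕ => μ) (⋃ x ∈ D, uncovered r N x) ≤ 2 := by
  classical
  have : Countable D := hD
  have hunion : (⋃ x ∈ D, uncovered r N x) =
      ⋃ F : Finset D, ⋃ x ∈ F.image Subtype.val, uncovered r N x := by
    refine subset_antisymm (iUnion₂_subset fun x hx => ?_) (iUnion_subset fun F =>
      iUnion₂_subset fun x hx => ?_)
    · refine subset_iUnion_of_subset {⟨x, hx⟩} ?_
      simp
    · obtain ⟨z, -, rfl⟩ := Finset.mem_image.1 hx
      exact subset_biUnion_of_mem (u := uncovered r N) z.2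
  rw [hunion, Directed.measure_iUnion, ENNReal.mul_iSup]
  · refine iSup_le fun F => mul_measure_biUnion_uncovered_le_two μ r N _ ν ?_ hν ?_
    all_goals
      intro x hx
      obtain ⟨z, -, rfl⟩ := Finset.mem_image.1 hx
    · exact hF z z.2
    · exact hc z z.2
  · refine Monotone.directed_le fun F F' h => ?_
    exact biUnion_subset_biUnion_left (Finset.coe_subset.2 (Finset.image_subset_image h))

/-- Every set of reals has a countable subset which approximates all the other points of the set
from both sides. -/
lemma exists_countable_two_sided_dense (A : Set ℝ) :
    ∃ D ⊆ A, D.Countable ∧ ∀ x ∈ A, x ∈ D ∨ x ∈ closure (Ioi x ∩ D) ∧ x ∈ closure (Iio x ∩ D) := by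
  obtain ⟨t, htA, htc, hAt⟩ :=
    (TopologicalSpace.IsSeparable.of_separableSpace A).exists_countable_dense_subset
  refine ⟨t ∪ ({x ∈ A | 𝓝[A ∩ Ioi x] x = ⊥} ∪ {x ∈ A | 𝓝[A ∩ Iio x] x = ⊥}),
    union_subset htA (union_subset (sep_subset _ _) (sep_subset _ _)),
    htc.union (countable_setOfPred_isolated_right_within.union
      countable_setOfPred_isolated_left_within), fun x hx => ?_⟩
  have key : ∀ I : Set ℝ, IsOpen I → 𝓝[A ∩ I] x ≠ ⊥ → x ∈ closure (I ∩ t) := by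
    intro I hI hne
    have h₁ : x ∈ closure (A ∩ I) := mem_closure_iff_nhdsWithin_neBot.2 ⟨hne⟩
    refine closure_minimal ?_ isClosed_closure h₁
    exact fun y hy => hI.inter_closure ⟨hy.2, hAt hy.1⟩
  by_cases hr : 𝓝[A ∩ Ioi x] x = ⊥
  · exact .inl (.inr (.inl ⟨hx, hr⟩))
  by_cases hl : 𝓝[A ∩ Iio x] x = ⊥
  · exact .inl (.inr (.inr ⟨hx, hl⟩))
  exact .inr ⟨closure_mono (inter_subset_inter_right _ subset_union_left) (key _ isOpen_Ioi hr),
    closure_mono (inter_subset_inter_right _ subset_union_left) (key _ isOpen_Iio hl)⟩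

/-- Almost surely, no point of a closed set whose spheres are null lies on the boundaries of two
different balls. -/
lemma ae_not_mem_two_spheres (μ : Measure ℝ) [IsProbabilityMeasure μ] (r : ℕ → ℝ) {C : Set ℝ}
    (hC : IsClosed C) (hsph : ∀ x ∈ C, ∀ n, μ (sphere x (r n)) = 0) :
    ∀ᵐ ω ∂Measure.infinitePi (fun _ : ℕ => μ), ∀ n m, n ≠ m →
      ∀ x ∈ C, ω n ∈ sphere x (r n) → ω m ∉ sphere x (r m) := by
  have key : ∀ n m, n ≠ m → ∀ δ : ℝ, ∀ᵐ ω ∂Measure.infinitePi (fun _ : ℕ => μ),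
      ¬ (ω n + δ ∈ C ∧ ω m ∈ sphere (ω n + δ) (r m)) := by
    intro n m hnm δ
    have hS : MeasurableSet {p : ℝ × ℝ | p.1 + δ ∈ C ∧ p.2 ∈ sphere (p.1 + δ) (r m)} := by
      refine MeasurableSet.inter ?_ ?_
      · exact hC.measurableSet.preimage (by fun_prop)
      · exact measurableSet_eq_fun (by fun_prop) measurable_const
    have hprod : (μ.prod μ) {p : ℝ × ℝ | p.1 + δ ∈ C ∧ p.2 ∈ sphere (p.1 + δ) (r m)} = 0 := by
      rw [Measure.measure_prod_null hS]
      refine Eventually.of_forall fun s => ?_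
      by_cases hs : s + δ ∈ C
      · exact measure_mono_null (fun t ht => ht.2) (hsph _ hs m)
      · exact measure_mono_null (fun t ht => (hs ht.1).elim) measure_empty
    rw [← Measure.infinitePi_map_eval_prod (P := fun _ : ℕ => μ) hnm,
      Measure.map_apply (by fun_prop) hS] at hprod
    rw [ae_iff]
    simpa using hprod
  rw [ae_all_iff]; intro n
  rw [ae_all_iff]; intro m
  by_cases hnm : n = m
  · exact Eventually.of_forall fun _ h => (h hnm).elim
  filter_upwards [key n m hnm (r n), key n m hnm (-r n)] with ω h₁ h₂ _ x hx hn hm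
  rw [mem_sphere, Real.dist_eq] at hn
  rcases abs_choice (ω n - x) with h | h <;> rw [h] at hn
  · have : ω n + -r n = x := by linarith
    exact h₂ (this ▸ ⟨hx, hm⟩)
  · have : ω n + r n = x := by linarith
    exact h₁ (this ▸ ⟨hx, hm⟩)

/-- An uncovered point lying on at most one ball boundary has a one-sided neighbourhood of
uncovered points. -/
lemma eventually_mem_uncovered {r : ℕ → ℝ} (hpos : ∀ n, 0 < r n) {N : Finset ℕ} {x : ℝ}
    {ω : ℕ → ℝ} (hω : ω ∈ uncovered r N x)
    (hsph : ∀ n m, n ≠ m → ω n ∈ sphere x (r n) → ω m ∉ sphere x (r m)) :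
    (∀ᶠ d in 𝓝[>] x, ω ∈ uncovered r N d) ∨ ∀ᶠ d in 𝓝[<] x, ω ∈ uncovered r N d := by
  have hle : ∀ n ∈ N, r n ≤ dist (ω n) x := fun n hn => by
    simpa [mem_ball, not_lt] using hω n hn
  have hstrict : ∀ n ∈ N, ω n ∉ sphere x (r n) → ∀ᶠ d in 𝓝 x, ω n ∈ (ball d (r n))ᶜ := by
    intro n hn hns
    have hlt : r n < dist (ω n) x := lt_of_le_of_ne (hle n hn) fun h => hns h.symm
    have hcont : ContinuousAt (fun d => dist (ω n) d) x := by fun_prop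
    filter_upwards [hcont.eventually_const_lt hlt] with d hd
    simpa [mem_ball, not_lt] using hd.le
  by_cases h : ∃ n ∈ N, ω n ∈ sphere x (r n)
  · obtain ⟨n, hn, hns⟩ := h
    have hother : ∀ m ∈ N, m ≠ n → ∀ᶠ d in 𝓝 x, ω m ∈ (ball d (r m))ᶜ :=
      fun m hm hmn => hstrict m hm (hsph n m hmn.symm hns)
    have hr := hpos n
    rw [mem_sphere, Real.dist_eq] at hns
    rcases lt_or_ge (ω n) x with hlt | hge
    · left
      refine (Finset.eventually_all N).2 fun m hm => ?_
      rcases eq_or_ne m n with rfl | hmn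
      · filter_upwards [self_mem_nhdsWithin] with d hd
        rw [mem_Ioi] at hd
        rw [abs_of_neg (by linarith)] at hns
        rw [mem_compl_iff, mem_ball, Real.dist_eq, not_lt, abs_of_neg (by linarith)]
        linarith
      · exact nhdsWithin_le_nhds (hother m hm hmn)
    · right
      refine (Finset.eventually_all N).2 fun m hm => ?_
      rcases eq_or_ne m n with rfl | hmn
      · filter_upwards [self_mem_nhdsWithin] with d hd
        rw [mem_Iio] at hd
        rw [abs_of_nonneg (by linarith)] at hns
        rw [mem_compl_iff, mem_ball, Real.dist_eq, not_lt, abs_of_nonneg (by linarith)]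
        linarith
      · exact nhdsWithin_le_nhds (hother m hm hmn)
  · push Not at h
    exact .inl ((Finset.eventually_all N).2 fun m hm => nhdsWithin_le_nhds (hstrict m hm (h m hm)))

/-- A subset, on which the potential is large, of a closed set with null spheres is likely to be
covered. -/
lemma mul_measure_exists_uncovered_le_two (μ : Measure ℝ) [IsProbabilityMeasure μ]
    {r : ℕ → ℝ} (hpos : ∀ n, 0 < r n) (N : Finset ℕ) {C : Set ℝ} (hC : IsClosed C)
    (hsph : ∀ x ∈ C, ∀ n, μ (sphere x (r n)) = 0) (hF : ∀ x ∈ C, ∀ n, μ (ball x (r n))ᶜ ≠ 0)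
    (ν : Measure ℝ) [IsProbabilityMeasure ν] (hν : ∀ᵐ y ∂ν, y ∈ C) {c : ℝ≥0∞}
    {A : Set ℝ} (hAC : A ⊆ C) (hc : ∀ x ∈ A, 2 * c ≤ ∫⁻ y, overlap μ r N x y ∂ν) :
    c * Measure.infinitePi (fun _ : ℕ => μ) {ω | ∃ x ∈ A, ω ∈ uncovered r N x} ≤ 2 := by
  obtain ⟨D, hDA, hDc, hD⟩ := exists_countable_two_sided_dense A
  refine le_trans (mul_le_mul_right (measure_mono_ae ?_) c)
    (mul_measure_biUnion_uncovered_le_two_of_countable μ r N hDc ν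
      (fun x hx => hF x (hAC (hDA hx))) (hν.mono fun y hy => hF y hy) fun x hx => hc x (hDA hx))
  filter_upwards [ae_not_mem_two_spheres μ r hC hsph] with ω hω ⟨x, hx, hxω⟩
  suffices ∃ d ∈ D, ω ∈ uncovered r N d by
    obtain ⟨d, hd, hdω⟩ := this
    exact mem_biUnion hd hdω
  rcases hD x hx with hxD | ⟨hr, hl⟩
  · exact ⟨x, hxD, hxω⟩
  have key : ∀ I : Set ℝ, x ∈ closure (I ∩ D) → (∀ᶠ d in 𝓝[I] x, ω ∈ uncovered r N d) →
      ∃ d ∈ D, ω ∈ uncovered r N d := by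
    intro I hI hev
    obtain ⟨d, ⟨hdI, hdD⟩, hd⟩ := ((mem_closure_iff_frequently.1 hI).and_eventually
      (eventually_nhdsWithin_iff.1 hev)).exists
    exact ⟨d, hdD, hd hdI⟩
  rcases eventually_mem_uncovered hpos hxω fun n m hnm => hω n m hnm x (hAC hx) with h | h
  · exact key _ hr h
  · exact key _ hl h

lemma pk_eq_toReal_overlap (μ : Measure ℝ) [IsProbabilityMeasure μ] (r : ℕ → ℝ) (k : ℕ)
    (x y : ℝ) : pk μ r k x y = (overlap μ r (Finset.range k) x y).toReal := by
  rw [pk, overlap, ENNReal.toReal_prod]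
  refine Finset.prod_congr rfl fun n _ => ?_
  have hcompl : ∀ z, (μ (ball z (r n))ᶜ).toReal = 1 - (μ (ball z (r n))).toReal := fun z =>
    probReal_compl_eq_one_sub measurableSet_ball
  have hinter : (μ ((ball x (r n))ᶜ ∩ (ball y (r n))ᶜ)).toReal =
      1 - (μ (ball x (r n))).toReal - (μ (ball y (r n))).toReal +
        (μ (ball x (r n) ∩ ball y (r n))).toReal := by
    have h₁ : (μ (ball x (r n) ∪ ball y (r n))ᶜ).toReal =
        1 - (μ (ball x (r n) ∪ ball y (r n))).toReal :=
      probReal_compl_eq_one_sub (measurableSet_ball.union measurableSet_ball)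
    have h₂ : (μ (ball x (r n) ∪ ball y (r n))).toReal + (μ (ball x (r n) ∩ ball y (r n))).toReal =
        (μ (ball x (r n))).toReal + (μ (ball y (r n))).toReal :=
      measureReal_union_add_inter measurableSet_ball
    rw [← compl_union, h₁]
    linarith
  rw [ENNReal.toReal_div, ENNReal.toReal_mul, hcompl, hcompl, hinter]

lemma ofReal_integral_pk_le (μ : Measure ℝ) [IsProbabilityMeasure μ] (r : ℕ → ℝ) (k : ℕ) (x : ℝ)
    (ν : Measure ℝ) :
    ENNReal.ofReal (∫ y, pk μ r k x y ∂ν) ≤ ∫⁻ y, overlap μ r (Finset.range k) x y ∂ν := by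
  have hov : Measurable (overlap μ r (Finset.range k) x) :=
    Measurable.of_uncurry_left (measurable_overlap μ r _)
  simp_rw [pk_eq_toReal_overlap]
  rw [integral_eq_lintegral_of_nonneg_ae (Eventually.of_forall fun _ => ENNReal.toReal_nonneg)
    hov.ennreal_toReal.aestronglyMeasurable]
  exact ENNReal.ofReal_toReal_le.trans (lintegral_mono fun y => ENNReal.ofReal_toReal_le)

lemma measurable_integral_pk (μ : Measure ℝ) [IsProbabilityMeasure μ] (r : ℕ → ℝ) (k : ℕ)
    (ν : Measure ℝ) [SFinite ν] : Measurable fun x => ∫ y, pk μ r k x y ∂ν := by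
  simp_rw [pk_eq_toReal_overlap]
  exact (StronglyMeasurable.integral_prod_right (ν := ν)
    (f := fun x y => (overlap μ r (Finset.range k) x y).toReal)
    (measurable_overlap μ r _).ennreal_toReal.stronglyMeasurable).measurable

/-- Dropping the first `j` factors decreases the pair correlation at most by a constant factor. -/
lemma overlap_range_le (μ : Measure ℝ) [IsProbabilityMeasure μ] (r : ℕ → ℝ) {j k : ℕ}
    (hjk : j ≤ k) {δ : ℝ≥0∞} {x y : ℝ} (hx : ∀ n, δ ≤ μ (ball x (r n))ᶜ)
    (hy : ∀ n, δ ≤ μ (ball y (r n))ᶜ) :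
    overlap μ r (Finset.range k) x y ≤ ((δ * δ)⁻¹) ^ j * overlap μ r (Finset.Ico j k) x y := by
  rw [overlap, overlap, ← Finset.prod_range_mul_prod_Ico _ hjk]
  gcongr
  refine (Finset.prod_le_pow_card _ _ ((δ * δ)⁻¹) fun n _ => ?_).trans_eq (by simp)
  rw [ENNReal.div_eq_inv_mul]
  calc _ ≤ (δ * δ)⁻¹ * 1 := by
        gcongr
        · exact hx n
        · exact hy n
        · exact prob_le_one
    _ = _ := mul_one _

lemma ae_mem_of_msupport_subset {ν : Measure ℝ} {C : Set ℝ} (h : msupport ν ⊆ C) :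
    ∀ᵐ y ∂ν, y ∈ C := by
  refine measure_null_of_locally_null Cᶜ fun x hx => ?_
  have hx' : x ∉ msupport ν := fun hx' => hx (h hx')
  simp only [msupport, mem_ofPred_eq, not_forall, not_lt, nonpos_iff_eq_zero] at hx'
  obtain ⟨U, hU, hxU, hU0⟩ := hx'
  exact ⟨U, mem_nhdsWithin_of_mem_nhds (hU.mem_nhds hxU), hU0⟩

/-- If the potentials `∫ p_k(x,·) dν` blow up in `ν`-measure on a compact `C ⊆ X₀`, then there
is a deterministic Borel set `C_ν ⊆ C` of full `ν`-measure which is a.s. covered by `E_r`. -/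
theorem deterministic_full_measure_covered_set
    (μ : Measure ℝ) [IsProbabilityMeasure μ]
    (P : Measure (ℕ → ℝ))
    (hP : ∀ (s : Finset ℕ) (f : ℕ → Set ℝ), (∀ n, MeasurableSet (f n)) →
      P {ω | ∀ n ∈ s, ω n ∈ f n} = ∏ n ∈ s, μ (f n))
    (r : ℕ → ℝ) (hmono : Antitone r) (hpos : ∀ n, 0 < r n)
    (hlim : Tendsto r atTop (𝓝 0))
    (hsmall : (⨆ x ∈ msupport μ, μ (ball x (r 0))) < 1)
    (C : Set ℝ) (hCne : C.Nonempty) (hCc : IsCompact C) (hCX : C ⊆ X₀ μ r)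
    (ν : Measure ℝ) (hν : IsProbabilityMeasure ν) (hνC : msupport ν ⊆ C)
    (hblow : ∀ M : ℝ, 0 < M →
      Tendsto (fun k : ℕ => ν {x ∈ C | M ≤ ∫ y, pk μ r k x y ∂ν}) atTop (𝓝 1)) :
    ∃ B : Set ℝ, MeasurableSet B ∧ B ⊆ C ∧ ν B = 1 ∧
      P {ω | B ⊆ coverSet r ω} = 1 := by
  have hPinf : P = Measure.infinitePi fun _ : ℕ => μ :=
    Measure.eq_infinitePi _ fun s t ht => hP s t ht
  have hPprob : IsProbabilityMeasure P := hPinf ▸ inferInstance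
  have hC : IsClosed C := hCc.isClosed
  have hνae : ∀ᵐ y ∂ν, y ∈ C := ae_mem_of_msupport_subset hνC
  have hsph : ∀ x ∈ C, ∀ n, μ (sphere x (r n)) = 0 := fun x hx n => by
    rw [← frontier_ball x (hpos n).ne']
    exact (hCX hx).2 n
  obtain ⟨δ, hδ0, hδ1, hδ⟩ : ∃ δ : ℝ≥0∞, δ ≠ 0 ∧ δ ≠ ∞ ∧ ∀ x ∈ C, ∀ n, δ ≤ μ (ball x (r n))ᶜ := by
    refine ⟨1 - ⨆ x ∈ msupport μ, μ (ball x (r 0)), (tsub_pos_of_lt hsmall).ne',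
      ENNReal.sub_ne_top ENNReal.one_ne_top, fun x hx n => ?_⟩
    rw [prob_compl_eq_one_sub measurableSet_ball]
    refine tsub_le_tsub_left ((measure_mono (ball_subset_ball (hmono (Nat.zero_le n)))).trans ?_) 1
    exact le_iSup₂ (f := fun x (_ : x ∈ msupport μ) => μ (ball x (r 0))) x (hCX hx).1
  have hF : ∀ x ∈ C, ∀ n, μ (ball x (r n))ᶜ ≠ 0 := fun x hx n =>
    (hδ0.bot_lt.trans_le (hδ x hx n)).ne'
  set K : ℝ≥0∞ := (δ * δ)⁻¹ with hK
  have hK0 : K ≠ 0 := ENNReal.inv_ne_zero.2 (ENNReal.mul_ne_top hδ1 hδ1)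
  have hKtop : K ≠ ∞ := ENNReal.inv_ne_top.2 (mul_ne_zero hδ0 hδ0)
  set M : ℕ → ℝ≥0∞ := fun j => K ^ j * (2 * 2 ^ j) with hM
  have hM0 : ∀ j, M j ≠ 0 := fun j => by simp [hM, hK0]
  have hMtop : ∀ j, M j ≠ ∞ := fun j =>
    ENNReal.mul_ne_top (ENNReal.pow_ne_top hKtop)
      (ENNReal.mul_ne_top ENNReal.ofNat_ne_top (ENNReal.pow_ne_top ENNReal.ofNat_ne_top))
  have hchoice : ∀ j : ℕ, ∃ k, j ≤ k ∧
      1 - (2⁻¹ : ℝ≥0∞) ^ j < ν {x ∈ C | (M j).toReal ≤ ∫ y, pk μ r k x y ∂ν} := fun j =>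
    ((eventually_ge_atTop j).and ((hblow _ (ENNReal.toReal_pos (hM0 j) (hMtop j))).eventually_const_lt
      (ENNReal.sub_lt_self ENNReal.one_ne_top one_ne_zero (by simp)))).exists
  choose k hjk hkν using hchoice
  set A : ℕ → Set ℝ := fun j => {x ∈ C | (M j).toReal ≤ ∫ y, pk μ r (k j) x y ∂ν} with hA
  have hAm : ∀ j, MeasurableSet (A j) := fun j =>
    hC.measurableSet.inter (measurableSet_le measurable_const (measurable_integral_pk μ r (k j) ν))
  have hAC : ∀ j, A j ⊆ C := fun j => sep_subset _ _
  have hAc : ∀ j, ∀ x ∈ A j, 2 * 2 ^ j ≤ ∫⁻ y, overlap μ r (Finset.Ico j (k j)) x y ∂ν := by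
    intro j x hx
    have h₁ : M j ≤ K ^ j * ∫⁻ y, overlap μ r (Finset.Ico j (k j)) x y ∂ν := by
      calc M j = ENNReal.ofReal (M j).toReal := (ENNReal.ofReal_toReal (hMtop j)).symm
        _ ≤ ENNReal.ofReal (∫ y, pk μ r (k j) x y ∂ν) := ENNReal.ofReal_le_ofReal hx.2
        _ ≤ ∫⁻ y, overlap μ r (Finset.range (k j)) x y ∂ν := ofReal_integral_pk_le μ r _ x ν
        _ ≤ ∫⁻ y, K ^ j * overlap μ r (Finset.Ico j (k j)) x y ∂ν := by
          refine lintegral_mono_ae ?_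
          filter_upwards [hνae] with y hy
          exact overlap_range_le μ r (hjk j) (hδ x hx.1) (hδ y hy)
        _ = _ := lintegral_const_mul _ (Measurable.of_uncurry_left (measurable_overlap μ r _))
    exact (ENNReal.mul_le_mul_iff_right (pow_ne_zero j hK0) (ENNReal.pow_ne_top hKtop)).1 h₁
  have hgeom : ∑' j : ℕ, (2⁻¹ : ℝ≥0∞) ^ j ≠ ∞ := by
    rw [ENNReal.tsum_geometric, ENNReal.one_sub_inv_two, inv_inv]
    exact ENNReal.ofNat_ne_top
  have hAν : ∀ᵐ x ∂ν, ∀ᶠ j in atTop, x ∈ A j := by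
    have : ∑' j, ν (A j)ᶜ ≠ ∞ := by
      refine ne_top_of_le_ne_top hgeom (ENNReal.tsum_le_tsum fun j => ?_)
      rw [prob_compl_eq_one_sub (hAm j), tsub_le_iff_left]
      exact tsub_le_iff_right.1 (hkν j).le
    filter_upwards [ae_eventually_notMem this] with x hx
    simpa using hx
  have hAP : ∀ᵐ ω ∂P, ∀ᶠ j in atTop, ω ∉ {ω | ∃ x ∈ A j, ω ∈ uncovered r (Finset.Ico j (k j)) x} := by
    refine ae_eventually_notMem (ne_top_of_le_ne_top
      (b := 2 * ∑' j : ℕ, (2⁻¹ : ℝ≥0∞) ^ j) (ENNReal.mul_ne_top ENNReal.ofNat_ne_top hgeom) ?_)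
    rw [← ENNReal.tsum_mul_left]
    refine ENNReal.tsum_le_tsum fun j => ?_
    rw [← ENNReal.inv_pow, ← div_eq_mul_inv, ENNReal.le_div_iff_mul_le (.inl (by simp))
      (.inl (by simp)), mul_comm, hPinf]
    exact mul_measure_exists_uncovered_le_two μ hpos _ hC hsph hF ν hνae (hAC j) (hAc j)
  have hBm : MeasurableSet {x | ∀ᶠ j in atTop, x ∈ A j} := by
    have : {x | ∀ᶠ j in atTop, x ∈ A j} = ⋃ n, ⋂ j, ⋂ (_ : n ≤ j), A j := by
      ext; simp [eventually_atTop]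
    rw [this]
    exact .iUnion fun n => .iInter fun j => .iInter fun _ => hAm j
  refine ⟨{x | ∀ᶠ j in atTop, x ∈ A j}, hBm, fun x hx => ?_, ?_, ?_⟩
  · obtain ⟨j, hj⟩ := hx.exists
    exact hAC j hj
  · exact (mem_ae_iff_prob_eq_one hBm).1 hAν
  · rw [← measure_univ (μ := P)]
    refine measure_congr (eventuallyEq_univ.2 ?_)
    filter_upwards [hAP] with ω hω x hx
    simp only [coverSet, mem_iInter, mem_iUnion]
    intro m
    obtain ⟨j, ⟨hj, hxj⟩, hmj⟩ := ((hω.and hx).and (eventually_ge_atTop m)).exists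
    by_contra hcon
    push Not at hcon
    refine hj ⟨x, hxj, fun n hn hb => hcon n (hmj.trans (Finset.mem_Ico.1 hn).1) ?_⟩
    exact mem_ball_comm.1 hb

end
end

section
/- Let μ be a Borel probability measure on ℝ with support X, let r = (r_n)_{n≥1} be a non-increasing sequence of positive real numbers tending to zero, let ε > 0, and let C ⊆ X ∖ (X_atom ∪ X_atomish) be a compact set such that ∑_{k=1}^∞ μ(B(x,r_k))^{1+ε} = ∞ for every x ∈ C. Then ℙ_μ({ω : C ⊆ E_r(ω)}) = 1. -/
open MeasureTheory Metric Filter Set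
open scoped ENNReal Topology

noncomputable section

/-- The atoms of `μ` inside its support. -/
def Xatom (μ : Measure ℝ) : Set ℝ := {x ∈ msupport μ | 0 < μ {x}}

/-- Points of the support at which some ball boundary `∂B(x,r_k)` has positive measure. -/
def Xatomish (μ : Measure ℝ) (r : ℕ → ℝ) : Set ℝ :=
  {x ∈ msupport μ | ∃ k : ℕ, 0 < μ (frontier (ball x (r k)))}

open ProbabilityTheory

/-- Finitely many sets of mass at least `b` suffice to meet all intervals of mass `4 * b`. -/
lemma exists_subset_Ioo_of_measure_ge (μ : Measure ℝ) [IsProbabilityMeasure μ] {b : ℝ}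
    (hb : 0 < b) :
    ∃ S : ℕ → Set ℝ, (∀ j, MeasurableSet (S j)) ∧ ∀ u v, 4 * b ≤ μ.real (Ioo u v) →
      ∃ j : ℕ, j * b ≤ 1 ∧ S j ⊆ Ioo u v ∧ b ≤ μ.real (S j) := by
  set f := cdf μ
  let t : ℕ → ℝ := fun j => sInf {x | j * b ≤ f x}
  refine ⟨fun j => Icc (t j) (t (j + 1)), fun j => measurableSet_Icc, fun u v huv => ?_⟩
  have hIoo : μ.real (Ioo u v) = max (Function.leftLim f v - f u) 0 := by
    conv_lhs => rw [← measure_cdf μ]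
    rw [measureReal_def, StieltjesFunction.measure_Ioo, ENNReal.toReal_ofReal']
  have hIcc (x y : ℝ) : μ.real (Icc x y) = max (f y - Function.leftLim f x) 0 := by
    conv_lhs => rw [← measure_cdf μ]
    rw [measureReal_def, StieltjesFunction.measure_Icc, ENNReal.toReal_ofReal']
  have hgap : f u + 4 * b ≤ Function.leftLim f v := by
    rw [hIoo] at huv
    rcases le_max_iff.1 huv with h | h <;> linarith
  have hmono : Monotone f := monotone_cdf μ
  obtain ⟨w, hwv, hw⟩ : ∃ w < v, f u + 3 * b < f w := by
    by_contra! h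
    have : Function.leftLim f v ≤ f u + 3 * b :=
      le_of_tendsto (hmono.tendsto_leftLim v) (eventually_mem_nhdsWithin.mono fun w hw => h w hw)
    linarith
  have hlt (j : ℕ) (hj : f u < j * b) (hj' : j * b ≤ f w) :
      j * b ≤ f (t j) ∧ t j ≤ w ∧ u < t j ∧ Function.leftLim f (t j) ≤ j * b := by
    have hbdd : BddBelow {x | j * b ≤ f x} :=
      ⟨u, fun x hx => le_of_not_gt fun h => by linarith [hmono h.le, show j * b ≤ f x from hx]⟩
    have hne : {x | j * b ≤ f x}.Nonempty := ⟨w, hj'⟩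
    have h1 : j * b ≤ f (t j) := by
      refine ge_of_tendsto ((f.right_continuous (t j)).tendsto.mono_left
        (nhdsWithin_mono _ Ioi_subset_Ici_self)) (eventually_mem_nhdsWithin.mono fun x hx => ?_)
      obtain ⟨y, hy, hyx⟩ := exists_lt_of_csInf_lt hne (mem_Ioi.1 hx)
      exact le_trans hy (hmono hyx.le)
    refine ⟨h1, csInf_le hbdd hj', ?_, ?_⟩
    · by_contra! h
      linarith [hmono h]
    · refine le_of_tendsto (hmono.tendsto_leftLim _) (eventually_mem_nhdsWithin.mono fun x hx => ?_)
      by_contra! h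
      exact absurd (csInf_le hbdd h.le) (not_le.2 hx)
  have h0 : 0 ≤ f u := cdf_nonneg μ u
  have hw1 : f w ≤ 1 := cdf_le_one μ w
  have hfl := Nat.floor_le (div_nonneg h0 hb.le)
  have hfl' := Nat.lt_floor_add_one (f u / b)
  rw [le_div_iff₀ hb] at hfl
  rw [div_lt_iff₀ hb] at hfl'
  obtain ⟨-, -, h1, h2⟩ := hlt (⌊f u / b⌋₊ + 1) (by push_cast; linarith) (by push_cast; linarith)
  obtain ⟨h3, h4, -, -⟩ := hlt (⌊f u / b⌋₊ + 1 + 1) (by push_cast; linarith)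
    (by push_cast; linarith)
  refine ⟨⌊f u / b⌋₊ + 1, by push_cast; linarith,
    fun x hx => ⟨h1.trans_le hx.1, (hx.2.trans h4).trans_lt hwv⟩, ?_⟩
  rw [hIcc]
  refine le_max_of_le_left ?_
  push_cast at h2 h3
  linarith

/-- With high probability, the points sampled at times in `s` meet all intervals of mass
at least `4 * b`. -/
lemma measure_exists_Ioo_missed_le (μ : Measure ℝ) [IsProbabilityMeasure μ]
    (P : Measure (ℕ → ℝ))
    (hP : ∀ (s : Finset ℕ) (f : ℕ → Set ℝ), (∀ n, MeasurableSet (f n)) →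
      P {ω | ∀ n ∈ s, ω n ∈ f n} = ∏ n ∈ s, μ (f n)) {b : ℝ} (hb : 0 < b) (s : Finset ℕ) :
    P {ω | ∃ u v, 4 * b ≤ μ.real (Ioo u v) ∧ ∀ k ∈ s, ω k ∉ Ioo u v} ≤
      ENNReal.ofReal ((1 / b + 1) * Real.exp (-(b * s.card))) := by
  classical
  obtain ⟨S, hS, hSsub⟩ := exists_subset_Ioo_of_measure_ge μ hb
  let J := (Finset.range (⌊1 / b⌋₊ + 1)).filter fun j => b ≤ μ.real (S j)
  have hsub : {ω : ℕ → ℝ | ∃ u v, 4 * b ≤ μ.real (Ioo u v) ∧ ∀ k ∈ s, ω k ∉ Ioo u v} ⊆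
      ⋃ j ∈ J, {ω | ∀ k ∈ s, ω k ∈ (S j)ᶜ} := by
    rintro ω ⟨u, v, huv, hω⟩
    obtain ⟨j, hj, hjs, hjb⟩ := hSsub u v huv
    refine mem_iUnion₂.2 ⟨j, ?_, fun k hk h => hω k hk (hjs h)⟩
    simp only [J, Finset.mem_filter, Finset.mem_range, Nat.lt_add_one_iff]
    exact ⟨Nat.le_floor (by rwa [le_div_iff₀ hb]), hjb⟩
  have hcard : (J.card : ℝ) ≤ 1 / b + 1 := by
    have h1 : J.card ≤ ⌊1 / b⌋₊ + 1 := by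
      exact (Finset.card_filter_le _ _).trans_eq (Finset.card_range _)
    have h2 : (J.card : ℝ) ≤ ⌊1 / b⌋₊ + 1 := by exact_mod_cast h1
    linarith [Nat.floor_le (one_div_pos.2 hb).le]
  have hterm : ∀ j ∈ J, P {ω | ∀ k ∈ s, ω k ∈ (S j)ᶜ} ≤
      ENNReal.ofReal (Real.exp (-(b * s.card))) := by
    intro j hj
    have hjb : b ≤ μ.real (S j) := (Finset.mem_filter.1 hj).2
    rw [hP s (fun _ => (S j)ᶜ) fun _ => (hS j).compl, Finset.prod_const,
      ← ofReal_measureReal, ← ENNReal.ofReal_pow measureReal_nonneg,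
      probReal_compl_eq_one_sub (hS j)]
    refine ENNReal.ofReal_le_ofReal ?_
    have hle : 1 - μ.real (S j) ≤ Real.exp (-b) := by
      linarith [Real.add_one_le_exp (-b)]
    calc (1 - μ.real (S j)) ^ s.card ≤ Real.exp (-b) ^ s.card :=
          pow_le_pow_left₀ (sub_nonneg.2 measureReal_le_one) hle _
      _ = Real.exp (-(b * s.card)) := by rw [← Real.exp_nat_mul]; congr 1; ring
  calc _ ≤ ∑ j ∈ J, P {ω | ∀ k ∈ s, ω k ∈ (S j)ᶜ} :=
        (measure_mono hsub).trans (measure_biUnion_finset_le _ _)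
    _ ≤ ∑ _j ∈ J, ENNReal.ofReal (Real.exp (-(b * s.card))) := Finset.sum_le_sum hterm
    _ = ENNReal.ofReal (J.card * Real.exp (-(b * s.card))) := by
        rw [Finset.sum_const, nsmul_eq_mul, ENNReal.ofReal_mul (Nat.cast_nonneg _),
          ENNReal.ofReal_natCast]
    _ ≤ _ := ENNReal.ofReal_le_ofReal (by gcongr)

lemma summable_mul_exp_neg_rpow {c d : ℝ} (hc : 0 < c) (hd : 0 < d) :
    Summable fun n : ℕ => ((n : ℝ) + 1) * Real.exp (-d * ((n : ℝ) + 1) ^ c) := by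
  have hy : Tendsto (fun n : ℕ => (n : ℝ) + 1) atTop atTop :=
    tendsto_atTop_add_const_right _ _ tendsto_natCast_atTop_atTop
  have ho := ((isLittleO_exp_neg_mul_rpow_atTop hd (-3 / c)).comp_tendsto
    ((tendsto_rpow_atTop hc).comp hy)).isBigO
  have hsum : Summable fun n : ℕ => ((n : ℝ) + 1) ^ (-2 : ℝ) := by
    simpa using (summable_nat_add_iff 1).2 (Real.summable_nat_rpow.2 (by norm_num : (-2 : ℝ) < -1))
  refine summable_of_isBigO_nat hsum ?_
  refine ((Asymptotics.isBigO_refl (fun n : ℕ => (n : ℝ) + 1) atTop).mul ho).congr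
    (fun n => rfl) fun n => ?_
  have hn : (0 : ℝ) < n + 1 := by positivity
  simp only [Function.comp]
  rw [← Real.rpow_mul hn.le, mul_div_cancel₀ _ hc.ne']
  nth_rewrite 1 [← Real.rpow_one ((n : ℝ) + 1)]
  rw [← Real.rpow_add hn]
  norm_num

lemma frequently_rpow_le_of_tsum_eq_top {q : ℕ → ℝ≥0∞} (hq : ∀ n, q n ≠ ∞) {p s : ℝ}
    (hp : 0 < p) (hs : 1 < s * p) (h : ∑' n, q n ^ p = ∞) :
    ∃ᶠ n : ℕ in atTop, ((n : ℝ) + 1) ^ (-s) ≤ (q n).toReal := by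
  by_contra hcon
  rw [not_frequently] at hcon
  have hsum : Summable fun n : ℕ => ((n : ℝ) + 1) ^ (-(s * p)) := by
    simpa using (summable_nat_add_iff 1).2
      (Real.summable_nat_rpow.2 (by linarith : -(s * p) < -1))
  have : Summable fun n => (q n).toReal ^ p := by
    refine Summable.of_norm_bounded_eventually_nat hsum (hcon.mono fun n hn => ?_)
    rw [Real.norm_of_nonneg (by positivity)]
    calc (q n).toReal ^ p ≤ (((n : ℝ) + 1) ^ (-s)) ^ p :=
          Real.rpow_le_rpow ENNReal.toReal_nonneg (not_le.1 hn).le hp.le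
      _ = _ := by rw [← Real.rpow_mul (by positivity)]; congr 1; ring
  refine this.tsum_ofReal_ne_top ?_
  rw [← h]
  refine tsum_congr fun n => ?_
  rw [← ENNReal.ofReal_rpow_of_nonneg ENNReal.toReal_nonneg hp.le, ENNReal.ofReal_toReal (hq n)]

/-- A compact set `C ⊆ X ∖ (X_atom ∪ X_atomish)` on which `∑_k μ(B(x,r_k))^{1+ε} = ∞`
is `ℙ_μ`-almost surely covered by `E_r`. -/
theorem compact_covered_of_one_plus_eps_divergence
    (μ : Measure ℝ) [IsProbabilityMeasure μ]
    (P : Measure (ℕ → ℝ))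
    (hP : ∀ (s : Finset ℕ) (f : ℕ → Set ℝ), (∀ n, MeasurableSet (f n)) →
      P {ω | ∀ n ∈ s, ω n ∈ f n} = ∏ n ∈ s, μ (f n))
    (r : ℕ → ℝ) (hmono : Antitone r) (hpos : ∀ n, 0 < r n)
    (hlim : Tendsto r atTop (𝓝 0))
    (ε : ℝ) (hε : 0 < ε)
    (C : Set ℝ) (hCc : IsCompact C)
    (hCX : C ⊆ msupport μ \ (Xatom μ ∪ Xatomish μ r))
    (hdiv : ∀ x ∈ C, (∑' k, μ (ball x (r k)) ^ (1 + ε : ℝ)) = ∞) :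
    P {ω | C ⊆ coverSet r ω} = 1 := by
  set s : ℝ := (1 + ε / 2) / (1 + ε) with hs
  have hs0 : 0 < s := by positivity
  have hs1 : s < 1 := by rw [hs, div_lt_one (by positivity)]; linarith
  have hsp : 1 < s * (1 + ε) := by rw [hs, div_mul_cancel₀ _ (by positivity)]; linarith
  let b : ℕ → ℝ := fun n => ((n : ℝ) + 1) ^ (-s) / 4
  let bad : ℕ → ℕ → Set (ℕ → ℝ) := fun m n =>
    {ω | ∃ u v, 4 * b n ≤ μ.real (Ioo u v) ∧ ∀ k ∈ Finset.Ico m (n + 1), ω k ∉ Ioo u v}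
  have hbad (m : ℕ) : ∀ᵐ ω ∂P, ∀ᶠ n in atTop, ω ∉ bad m n := by
    refine ae_eventually_notMem (ne_top_of_le_ne_top (b := ∑' n : ℕ, ENNReal.ofReal
      (5 * Real.exp m * (((n : ℝ) + 1) * Real.exp (-(1 / 4) * ((n : ℝ) + 1) ^ (1 - s)))))
      ?_ (ENNReal.tsum_le_tsum fun n => ?_))
    · exact ((summable_mul_exp_neg_rpow (sub_pos.2 hs1) (by norm_num)).mul_left _).tsum_ofReal_ne_top
    · have hy : (1 : ℝ) ≤ (n : ℝ) + 1 := by simp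
      have hy0 : (0 : ℝ) < (n : ℝ) + 1 := by positivity
      have hb0 : 0 < b n := by positivity
      have hb1 : b n ≤ 1 := by
        have := Real.rpow_le_one_of_one_le_of_nonpos hy (neg_nonpos.2 hs0.le)
        simp only [b]
        linarith
      refine (measure_exists_Ioo_missed_le μ P hP hb0 _).trans (ENNReal.ofReal_le_ofReal ?_)
      have hinv : 1 / b n ≤ 4 * ((n : ℝ) + 1) := by
        have h : ((n : ℝ) + 1) ^ s ≤ (n : ℝ) + 1 := by
          simpa using Real.rpow_le_rpow_of_exponent_le hy hs1.le
        simp only [b, Real.rpow_neg hy0.le]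
        rw [one_div_div, div_inv_eq_mul]
        linarith
      have hcard : (n : ℝ) + 1 - m ≤ (Finset.Ico m (n + 1)).card := by
        rw [Nat.card_Ico, sub_le_iff_le_add]
        exact_mod_cast (by omega : n + 1 ≤ n + 1 - m + m)
      have hpow : b n * ((n : ℝ) + 1) = 1 / 4 * ((n : ℝ) + 1) ^ (1 - s) := by
        have h : ((n : ℝ) + 1) ^ (1 - s) = ((n : ℝ) + 1) ^ (-s) * ((n : ℝ) + 1) := by
          rw [sub_eq_neg_add, Real.rpow_add hy0, Real.rpow_one]
        rw [h]
        simp only [b]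
        ring
      have hexp : -(b n * (Finset.Ico m (n + 1)).card) ≤
          m + -(1 / 4) * ((n : ℝ) + 1) ^ (1 - s) := by
        have h1 := mul_le_mul_of_nonneg_left hcard hb0.le
        have h2 := mul_le_mul_of_nonneg_right hb1 (Nat.cast_nonneg (α := ℝ) m)
        linarith
      calc _ ≤ (5 * ((n : ℝ) + 1)) * Real.exp (m + -(1 / 4) * ((n : ℝ) + 1) ^ (1 - s)) := by
            gcongr
            linarith
        _ = _ := by rw [Real.exp_add]; ring
  have huniv : P univ = 1 := by simpa using hP ∅ (fun _ => univ) fun _ => MeasurableSet.univ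
  rw [← huniv]
  refine measure_eq_measure_of_null_sdiff (subset_univ _) ?_
  rw [← compl_eq_univ_sdiff]
  change ∀ᵐ ω ∂P, C ⊆ coverSet r ω
  filter_upwards [ae_all_iff.2 hbad] with ω hω x hx
  refine mem_iInter.2 fun m => ?_
  obtain ⟨n, hn, hnot⟩ := ((frequently_rpow_le_of_tsum_eq_top (fun n => measure_ne_top μ _)
    (by positivity) hsp (hdiv x hx)).and_eventually (hω m)).exists
  simp only [bad, mem_ofPred_eq, not_exists, not_and, not_forall, not_not] at hnot
  obtain ⟨k, hk, hmem⟩ := hnot (x - r n) (x + r n) (by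
    rw [← Real.ball_eq_Ioo]
    simp only [b]
    rwa [mul_div_cancel₀ _ (by norm_num : (4 : ℝ) ≠ 0)])
  rw [Finset.mem_Ico] at hk
  rw [← Real.ball_eq_Ioo, mem_ball_comm] at hmem
  exact mem_iUnion₂.2 ⟨k, hk.1, ball_subset_ball (hmono (Nat.lt_add_one_iff.1 hk.2)) hmem⟩

end
end
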